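/- arXiv:2301.00569 — 2 statements merged into one kernel-verified Lean document; each statement's English description precedes it below -/
import Mathlib

section
/- Let (R, m) be a one-dimensional Cohen-Macaulay local ring and I an m-primary ideal with μ(I) < e(R) and type(R/I) ≥ e(R) − 1. Then I is Elias. -/
open CategoryTheory IsLocalRing

universe u

/-- The length of a module, as the Krull dimension of its submodule lattice. -/
noncomputable def rlength (R : Type u) (M : Type*) [Ring R] [AddCommGroup M]
    [Module R M] : WithBot ℕ∞ :=
  Order.krullDim (Submodule R M)

/-- `dim_k Ext^1_R(k, M)` (measured as `R`-length, which agrees with `k`-dimension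
since the module is killed by the maximal ideal). -/
noncomputable def modType (R : Type u) [CommRing R] [IsLocalRing R]
    (M : ModuleCat.{u} R) : WithBot ℕ∞ :=
  rlength R (((_root_.Ext R (ModuleCat.{u} R) 1).obj
    (Opposite.op (ModuleCat.of R (ResidueField R)))).obj M)

/-- The Cohen–Macaulay type of an `m`-primary ideal `I`:  `dim_k Ext^1_R(k, I)`. -/
noncomputable def idealType (R : Type u) [CommRing R] [IsLocalRing R] (I : Ideal R) :
    WithBot ℕ∞ :=
  modType R (ModuleCat.of R I)

/-- The Cohen–Macaulay type of `R/I`: `dim_k Hom_R(k, R/I)`. -/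
noncomputable def quotType (R : Type u) [CommRing R] [IsLocalRing R] (I : Ideal R) :
    WithBot ℕ∞ :=
  rlength R (ResidueField R →ₗ[R] R ⧸ I)

/-- An ideal is `m`-primary iff its radical is the maximal ideal. -/
def IsMPrimary (R : Type u) [CommRing R] [IsLocalRing R] (I : Ideal R) : Prop :=
  I.radical = maximalIdeal R

/-- `I` is Elias if `type(I) = type(R/I)`. -/
def EliasIdeal (R : Type u) [CommRing R] [IsLocalRing R] (I : Ideal R) : Prop :=
  idealType R I = quotType R I

/-- The minimal number of generators, as `dim_k I/mI`. -/
noncomputable def mu (R : Type u) [CommRing R] [IsLocalRing R] (I : Ideal R) :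
    WithBot ℕ∞ :=
  rlength R (I ⧸ (maximalIdeal R • ⊤ : Submodule R I))

/-- `R` has Hilbert–Samuel multiplicity `e`. -/
def HasMultiplicity (R : Type u) [CommRing R] [IsLocalRing R] (e : ℕ) : Prop :=
  ∃ N : ℕ, ∀ n ≥ N,
    rlength R (R ⧸ (maximalIdeal R) ^ (n + 1)) =
      rlength R (R ⧸ (maximalIdeal R) ^ n) + (e : WithBot ℕ∞)

open Polynomial in
/-- In a Noetherian ring, if `I` contains a regular element then `I ^ (n + 1) : I = I ^ n` for
large `n`. -/
theorem Ideal.exists_forall_mem_pow_of_mul_mem_pow_succ {R : Type*} [CommRing R]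
    [IsNoetherianRing R] (I : Ideal R) {z : R} (hz : z ∈ I) (hz' : z ∈ nonZeroDivisors R) :
    ∃ n₀, ∀ n ≥ n₀, ∀ f : R, (∀ a ∈ I, a * f ∈ I ^ (n + 1)) → f ∈ I ^ n := by
  obtain ⟨k, hk⟩ := I.exists_pow_inf_eq_pow_smul (M := R) (Ideal.span {z})
  let F' : I.Filtration R :=
    { N := fun n ↦ { carrier := {f | ∀ a ∈ I, a * f ∈ I ^ (n + 1)}
                     add_mem' := fun hf hg a ha ↦ by
                      rw [mul_add]; exact add_mem (hf a ha) (hg a ha)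
                     zero_mem' := fun a ha ↦ by simp
                     smul_mem' := fun c f hf a ha ↦ by
                      rw [smul_eq_mul, mul_left_comm]; exact Ideal.mul_mem_left _ _ (hf a ha) }
      mono := fun n f hf a ha ↦ Ideal.pow_le_pow_right (by omega) (hf a ha)
      smul_le := fun n ↦ by
        rw [Submodule.smul_le]
        intro r hr f hf a ha
        rw [smul_eq_mul, pow_succ']
        exact Ideal.mul_mem_mul ha (hf r hr) }
  let F : I.Filtration R :=
    { N := fun n ↦ I ^ (n - k)
      mono := fun n ↦ Ideal.pow_le_pow_right (by omega)
      smul_le := fun n ↦ by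
        rw [smul_eq_mul, ← pow_succ']
        exact Ideal.pow_le_pow_right (by omega) }
  have hF : F.Stable := by
    refine ⟨k, fun n hn ↦ ?_⟩
    change I • I ^ (n - k) = I ^ (n + 1 - k)
    rw [smul_eq_mul, ← pow_succ']
    congr 1
    omega
  have hle : F' ≤ F := by
    intro n f hf
    change f ∈ I ^ (n - k)
    rcases le_or_gt n k with hn | hn
    · simp [Nat.sub_eq_zero_of_le hn]
    have h1 : z * f ∈ I ^ (n + 1) • (⊤ : Submodule R R) ⊓ Ideal.span {z} := by
      refine ⟨?_, Ideal.mul_mem_right _ _ (Ideal.mem_span_singleton_self z)⟩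
      rw [smul_eq_mul, Ideal.mul_top]
      exact hf z hz
    rw [hk (n + 1) (by omega)] at h1
    have h2 := Submodule.smul_mono (le_refl (I ^ (n + 1 - k)))
      (inf_le_right : I ^ k • (⊤ : Submodule R R) ⊓ Ideal.span {z} ≤ _) h1
    rw [smul_eq_mul, mul_comm, Ideal.mem_span_singleton_mul] at h2
    obtain ⟨w, hw, hwz⟩ := h2
    rw [(mul_cancel_left_mem_nonZeroDivisors hz').mp hwz] at hw
    exact Ideal.pow_le_pow_right (by omega) hw
  obtain ⟨n₀, hn₀⟩ := hF.of_le hle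
  refine ⟨n₀ + 1, fun n hn f hf ↦ ?_⟩
  obtain ⟨n, rfl⟩ : ∃ m, n = m + 1 := ⟨n - 1, by omega⟩
  have h1 : f ∈ F'.N (n + 1) := hf
  rw [← hn₀ n (by omega)] at h1
  refine (Submodule.smul_le (P := (I ^ (n + 1) : Ideal R))).mpr ?_ h1
  intro r hr g hg
  exact hg r hr

open Polynomial in
theorem Polynomial.mem_map_C_pow_of_mul_mem {R : Type*} [CommRing R] {I : Ideal R} {n₀ : ℕ}
    (hn₀ : ∀ n ≥ n₀, ∀ f : R, (∀ a ∈ I, a * f ∈ I ^ (n + 1)) → f ∈ I ^ n)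
    {x : R[X]} (hx : I = Ideal.span (Set.range x.coeff)) {n : ℕ} (hn : n₀ ≤ n) {f : R[X]}
    (hf : f ∈ (I ^ n).map C) (hxf : x * f ∈ (I ^ (n + 2)).map C) :
    f ∈ (I ^ (n + 1)).map C := by
  have hxI (i : ℕ) : x.coeff i ∈ I := hx ▸ Ideal.subset_span ⟨i, rfl⟩
  suffices H : ∀ D : ℕ, ∀ n ≥ n₀, ∀ f ∈ (I ^ n).map C, (∀ i ≥ D, f.coeff i = 0) →
      x * f ∈ (I ^ (n + 2)).map C → f ∈ (I ^ (n + 1)).map C from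
    H (f.natDegree + 1) n hn f hf
      (fun i hi ↦ coeff_eq_zero_of_natDegree_lt (by omega)) hxf
  clear! f n
  intro D
  induction D with
  | zero =>
    intro n _ f _ h _
    obtain rfl : f = 0 := by ext i; simp [h i]
    exact zero_mem _
  | succ D ih =>
    intro n hn f hf hD hxf
    have hf' := Ideal.mem_map_C_iff.mp hf
    have hxf' := Ideal.mem_map_C_iff.mp hxf
    have split : f = f.erase D + C (f.coeff D) * X ^ D := by
      rw [C_mul_X_pow_eq_monomial, add_comm, monomial_add_erase]
    have herase : ∀ i ≥ D, (f.erase D).coeff i = 0 := by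
      intro i hi
      rw [coeff_erase]
      split_ifs with h
      · rfl
      · exact hD i (by omega)
    have herase' (J : Ideal R) (h : f ∈ J.map C) : f.erase D ∈ J.map C := by
      rw [Ideal.mem_map_C_iff] at h ⊢
      intro i
      rw [coeff_erase]
      split_ifs
      · exact zero_mem _
      · exact h i
    have hxC : x ∈ I.map C := Ideal.mem_map_C_iff.mpr hxI
    -- all coefficients of `x` multiply `f` into the right ideal
    have key : ∀ k i, x.natDegree < i + k → C (x.coeff i) * f ∈ (I ^ (n + 2)).map C := by
      intro k
      induction k with
      | zero =>
        intro i hi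
        rw [coeff_eq_zero_of_natDegree_lt (by omega)]
        simp
      | succ k ihk =>
        intro i hi
        have htop : x.coeff i * f.coeff D ∈ I ^ (n + 2) := by
          have h1 := hxf' (i + D)
          rw [coeff_mul] at h1
          have hmem : (i, D) ∈ Finset.HasAntidiagonal.antidiagonal (i + D) := by simp
          rw [← Finset.add_sum_erase _ _ hmem] at h1
          refine (Submodule.add_mem_iff_left _ (Submodule.sum_mem _ ?_)).mp h1
          rintro ⟨p, q⟩ hpq
          rw [Finset.mem_erase, Finset.HasAntidiagonal.mem_antidiagonal] at hpq
          obtain ⟨hne, hpq⟩ := hpq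
          dsimp only at hpq ⊢
          rcases lt_trichotomy p i with h | h | h
          · rw [hD q (by omega)]; simp
          · exact absurd (by ext <;> simp <;> omega) hne
          · simpa using Ideal.mem_map_C_iff.mp (ihk p (by omega)) q
        have hxiC : C (x.coeff i) * C (f.coeff D) * X ^ D ∈ (I ^ (n + 2)).map C := by
          rw [← C_mul]
          exact Ideal.mul_mem_right _ _ (Ideal.mem_map_of_mem C htop)
        have hg : C (x.coeff i) * f.erase D ∈ (I ^ (n + 1 + 1)).map C := by
          refine ih (n + 1) (by omega) _ ?_ ?_ ?_
          · rw [pow_succ', Ideal.map_mul]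
            exact Ideal.mul_mem_mul (Ideal.mem_map_of_mem C (hxI i)) (herase' _ hf)
          · intro j hj
            rw [coeff_C_mul, herase j hj, mul_zero]
          · have : x * (C (x.coeff i) * f.erase D) =
                C (x.coeff i) * (x * f) - x * (C (x.coeff i) * C (f.coeff D) * X ^ D) := by
              conv_rhs => rw [split]
              simp
              ring
            rw [this, show n + 1 + 2 = (n + 2) + 1 by ring, pow_succ', Ideal.map_mul]
            exact sub_mem (Ideal.mul_mem_mul (Ideal.mem_map_of_mem C (hxI i)) hxf)
              (Ideal.mul_mem_mul hxC hxiC)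
        rw [split, mul_add, ← mul_assoc]
        exact add_mem hg hxiC
    have key' (i : ℕ) : C (x.coeff i) * f ∈ (I ^ (n + 2)).map C :=
      key (x.natDegree + 1) i (by omega)
    rw [Ideal.mem_map_C_iff]
    intro j
    refine hn₀ (n + 1) (by omega) _ fun a ha ↦ ?_
    rw [hx] at ha
    induction ha using Submodule.span_induction with
    | mem a ha =>
      obtain ⟨i, rfl⟩ := ha
      simpa using Ideal.mem_map_C_iff.mp (key' i) j
    | zero => simp
    | add a b _ _ ha hb => rw [add_mul]; exact add_mem ha hb
    | smul c a _ ha => rw [smul_eq_mul, mul_assoc]; exact Ideal.mul_mem_left _ _ ha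

theorem Ideal.smul_top_eq_comap_subtype {R : Type*} [CommRing R] (I A : Ideal R) :
    (I • ⊤ : Submodule R A) = Submodule.comap A.subtype (I * A) := by
  refine Submodule.map_injective_of_injective (Submodule.injective_subtype A) ?_
  rw [Submodule.map_smul'', Submodule.map_top, Submodule.range_subtype,
    Submodule.map_comap_subtype, smul_eq_mul, right_eq_inf]
  exact Ideal.mul_le_right

theorem IsLocalRing.exists_span_range_eq_and_forall_mem {R : Type*} [CommRing R] [IsLocalRing R]
    {A : Ideal R} (hA : A.FG) {e : ℕ}
    (he : Module.length R (A ⧸ (maximalIdeal R • ⊤ : Submodule R A)) = e) :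
    ∃ u : Fin e → R, Ideal.span (Set.range u) = A ∧
      ∀ c : Fin e → R, ∑ j, c j * u j ∈ maximalIdeal R * A → ∀ j, c j ∈ maximalIdeal R := by
  let _ := Ideal.Quotient.field (maximalIdeal R)
  let V := A ⧸ (maximalIdeal R • ⊤ : Submodule R A)
  have : Module.Finite R A := Module.Finite.iff_fg.mpr hA
  have : Module.Finite (R ⧸ maximalIdeal R) V := Module.Finite.of_restrictScalars_finite R _ _
  have hfin : Module.finrank (R ⧸ maximalIdeal R) V = e := by
    rw [Module.length_eq_of_surjective (R := R ⧸ maximalIdeal R) Ideal.Quotient.mk_surjective,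
      Module.length_eq_finrank] at he
    exact_mod_cast he
  let b := Module.finBasisOfFinrankEq _ _ hfin
  choose u hu using fun j ↦ Submodule.mkQ_surjective _ (b j)
  have hsub (a : A) : (maximalIdeal R • ⊤ : Submodule R A).mkQ a = 0 ↔
      (a : R) ∈ maximalIdeal R * A := by
    rw [Submodule.mkQ_apply, Submodule.Quotient.mk_eq_zero, Ideal.smul_top_eq_comap_subtype]
    exact Submodule.mem_comap
  refine ⟨fun j ↦ u j, le_antisymm ?_ ?_, ?_⟩
  · rw [Ideal.span_le]
    rintro _ ⟨j, rfl⟩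
    exact (u j).2
  · refine Submodule.le_of_le_smul_of_le_jacobson_bot (I := maximalIdeal R) hA
      (jacobson_eq_maximalIdeal ⊥ bot_ne_top).ge ?_
    intro a ha
    have hrep := b.sum_repr ((maximalIdeal R • ⊤ : Submodule R A).mkQ ⟨a, ha⟩)
    choose c hc using fun j ↦ Ideal.Quotient.mk_surjective
      (b.repr ((maximalIdeal R • ⊤ : Submodule R A).mkQ ⟨a, ha⟩) j)
    have : (maximalIdeal R • ⊤ : Submodule R A).mkQ (⟨a, ha⟩ - ∑ j, c j • u j) = 0 := by
      rw [map_sub, map_sum, sub_eq_zero, ← hrep]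
      refine Finset.sum_congr rfl fun j _ ↦ ?_
      rw [map_smul, hu, ← hc]
      rfl
    rw [hsub] at this
    rw [← add_sub_cancel (∑ j, c j * (u j : R)) a]
    refine Submodule.add_mem_sup (sum_mem fun j _ ↦ Ideal.mul_mem_left _ _
      (Ideal.subset_span ⟨j, rfl⟩)) ?_
    simpa using this
  · intro c hc j
    have h0 : (maximalIdeal R • ⊤ : Submodule R A).mkQ (∑ j, c j • u j) = 0 := by
      rw [hsub]; simpa using hc
    rw [map_sum] at h0
    have h1 := Fintype.linearIndependent_iff.mp b.linearIndependent
      (fun j ↦ Ideal.Quotient.mk _ (c j)) (by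
        rw [← h0]
        refine Finset.sum_congr rfl fun j _ ↦ ?_
        rw [map_smul, hu]
        rfl) j
    exact Ideal.Quotient.eq_zero_iff_mem.mp h1

open Polynomial in
theorem IsLocalRing.exists_monic_mul_mem {R : Type*} [CommRing R] [IsLocalRing R]
    [IsNoetherianRing R] {n₀ : ℕ}
    (hn₀ : ∀ n ≥ n₀, ∀ f : R,
      (∀ a ∈ maximalIdeal R, a * f ∈ maximalIdeal R ^ (n + 1)) → f ∈ maximalIdeal R ^ n)
    {x : R[X]} (hx : maximalIdeal R = Ideal.span (Set.range x.coeff)) {n e : ℕ} (hn : n₀ ≤ n)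
    (h₁ : Module.length R ((maximalIdeal R ^ n : Ideal R) ⧸
      (maximalIdeal R • ⊤ : Submodule R (maximalIdeal R ^ n : Ideal R))) = e)
    (h₂ : Module.length R ((maximalIdeal R ^ (n + 1) : Ideal R) ⧸
      (maximalIdeal R • ⊤ : Submodule R (maximalIdeal R ^ (n + 1) : Ideal R))) = e) :
    ∃ p : R[X], p.Monic ∧ ∀ g ∈ maximalIdeal R ^ (n + 1),
      C g * p ∈ Ideal.span {x} * (maximalIdeal R ^ n).map C ⊔ (maximalIdeal R ^ (n + 2)).map C := by
  obtain ⟨u, hu, hu'⟩ := exists_span_range_eq_and_forall_mem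
    (maximalIdeal R ^ n).fg_of_isNoetherianRing h₁
  obtain ⟨w, hw, -⟩ := exists_span_range_eq_and_forall_mem
    (maximalIdeal R ^ (n + 1)).fg_of_isNoetherianRing h₂
  have huI (j) : C (u j) ∈ (maximalIdeal R ^ n).map C :=
    Ideal.mem_map_of_mem C (hu ▸ Ideal.subset_span ⟨j, rfl⟩)
  have hwI (j) : C (w j) ∈ (maximalIdeal R ^ (n + 1)).map C :=
    Ideal.mem_map_of_mem C (hw ▸ Ideal.subset_span ⟨j, rfl⟩)
  have hxI : x ∈ (maximalIdeal R).map C :=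
    Ideal.mem_map_C_iff.mpr fun i ↦ hx ▸ Ideal.subset_span ⟨i, rfl⟩
  have hP (j : Fin e) : ∃ P : Fin e → R[X], ∑ l, P l * C (w l) = x * C (u j) := by
    rw [← Ideal.mem_span_range_iff_exists_fun]
    have : Ideal.span (Set.range fun l ↦ C (w l)) = (maximalIdeal R ^ (n + 1)).map C := by
      rw [← hw, Ideal.map_span, ← Set.range_comp]
      rfl
    rw [this, pow_succ', Ideal.map_mul]
    exact Ideal.mul_mem_mul hxI (huI j)
  choose Q hQ using hP
  let P : Matrix (Fin e) (Fin e) R[X] := Matrix.of fun l j ↦ Q j l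
  let φ := mapRingHom (residue R)
  have hφ : Function.Surjective φ := map_surjective _ residue_surjective
  have hker (q : R[X]) (hq : φ q = 0) : q ∈ (maximalIdeal R).map C := by
    rw [Ideal.mem_map_C_iff]
    intro i
    rw [← residue_eq_zero_iff, ← coeff_map]
    change (φ q).coeff i = 0
    rw [hq, coeff_zero]
  have hdet : φ P.det ≠ 0 := by
    intro h0
    rw [RingHom.map_det] at h0
    obtain ⟨v, hv, hv0⟩ := Matrix.exists_mulVec_eq_zero_iff.mpr h0
    choose v' hv' using fun j ↦ hφ (v j)
    refine hv (funext fun j ↦ ?_)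
    have hf : ∑ j, v' j * C (u j) ∈ (maximalIdeal R ^ (n + 1)).map C := by
      refine mem_map_C_pow_of_mul_mem hn₀ hx hn
        (sum_mem fun j _ ↦ Ideal.mul_mem_left _ _ (huI j)) ?_
      have : x * ∑ j, v' j * C (u j) = ∑ l, (P.mulVec v') l * C (w l) := by
        simp_rw [Matrix.mulVec, dotProduct, Finset.mul_sum, Finset.sum_mul]
        rw [Finset.sum_comm]
        refine Finset.sum_congr rfl fun j _ ↦ ?_
        rw [mul_left_comm, ← hQ, Finset.mul_sum]
        refine Finset.sum_congr rfl fun l _ ↦ ?_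
        simp only [P, Matrix.of_apply]
        ring
      rw [this, pow_succ', Ideal.map_mul]
      refine sum_mem fun l _ ↦ Ideal.mul_mem_mul (hker _ ?_) (hwI l)
      rw [RingHom.map_mulVec]
      have : (φ ∘ v') = v := funext hv'
      rw [this]
      exact congrFun hv0 l
    rw [Ideal.mem_map_C_iff] at hf
    rw [← hv']
    ext i
    have := hu' (fun j ↦ (v' j).coeff i) (by
      rw [← pow_succ']
      simpa using hf i) j
    simpa [φ] using this
  have hdetw (l : Fin e) : P.det * C (w l) ∈ Ideal.span {x} * (maximalIdeal R ^ n).map C := by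
    have : P.det * C (w l) = x * ∑ j, P.adjugate j l * C (u j) := by
      rw [Finset.mul_sum]
      simp_rw [mul_left_comm x, ← hQ, Finset.mul_sum]
      rw [Finset.sum_comm]
      have h1 (l' : Fin e) : ∑ j, P.adjugate j l * (Q j l' * C (w l')) =
          (P * P.adjugate) l' l * C (w l') := by
        rw [Matrix.mul_apply, Finset.sum_mul]
        refine Finset.sum_congr rfl fun j _ ↦ ?_
        simp only [P, Matrix.of_apply]
        ring
      simp_rw [h1, Matrix.mul_adjugate]
      simp [Matrix.one_apply]
    rw [this]
    exact Ideal.mul_mem_mul (Ideal.mem_span_singleton_self x)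
      (sum_mem fun j _ ↦ Ideal.mul_mem_left _ _ (huI j))
  obtain ⟨p, hp, -, hpm⟩ := lifts_and_natDegree_eq_and_monic
    ((mem_lifts _).mpr (hφ (φ P.det * C (φ P.det).leadingCoeff⁻¹)))
    (monic_mul_leadingCoeff_inv hdet)
  obtain ⟨c, hc⟩ := hφ (C (φ P.det).leadingCoeff⁻¹)
  refine ⟨p, hpm, fun g hg ↦ ?_⟩
  have hgC : C g ∈ Ideal.span (Set.range fun l ↦ C (w l)) := by
    have : Ideal.span (Set.range fun l ↦ C (w l)) = (maximalIdeal R ^ (n + 1)).map C := by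
      rw [← hw, Ideal.map_span, ← Set.range_comp]
      rfl
    rw [this]
    exact Ideal.mem_map_of_mem C hg
  rw [show C g * p = C g * (P.det * c) + (p - P.det * c) * C g by ring]
  refine Submodule.add_mem_sup ?_ ?_
  · obtain ⟨s, hs⟩ := Ideal.mem_span_range_iff_exists_fun.mp hgC
    rw [← hs, Finset.sum_mul]
    refine sum_mem fun l _ ↦ ?_
    rw [show s l * C (w l) * (P.det * c) = (s l * c) * (P.det * C (w l)) by ring]
    exact Ideal.mul_mem_left _ _ (hdetw l)
  · rw [pow_succ', Ideal.map_mul]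
    refine Ideal.mul_mem_mul (hker _ ?_) (Ideal.mem_map_of_mem C hg)
    rw [map_sub, map_mul, hc, sub_eq_zero]
    exact hp

open Polynomial in
theorem Ideal.FG.exists_eq_span_range_coeff {R : Type*} [CommRing R] {I : Ideal R} (hI : I.FG) :
    ∃ x : R[X], I = Ideal.span (Set.range x.coeff) := by
  obtain ⟨r, s, hs⟩ := Submodule.fg_iff_exists_fin_generating_family.mp hI
  have hcoeff (j : ℕ) : (∑ i : Fin r, monomial i (s i)).coeff j =
      if h : j < r then s ⟨j, h⟩ else 0 := by
    simp_rw [finsetSum_coeff, coeff_monomial]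
    split_ifs with h
    · rw [Finset.sum_eq_single ⟨j, h⟩] <;> simp +contextual [Fin.ext_iff]
    · refine Finset.sum_eq_zero fun i _ ↦ if_neg ?_
      have := i.2
      omega
  refine ⟨∑ i : Fin r, monomial i (s i), ?_⟩
  rw [← hs]
  refine le_antisymm ?_ ?_ <;> rw [Submodule.span_le] <;> rintro _ ⟨j, rfl⟩
  · refine Ideal.subset_span ⟨j, ?_⟩
    simp [hcoeff]
  · rw [hcoeff]
    split_ifs
    · exact Submodule.subset_span ⟨_, rfl⟩
    · exact zero_mem _

theorem IsLocalRing.map_le_of_le_sup_map_maximalIdeal_mul {R S : Type*} [CommRing R]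
    [IsLocalRing R] [IsNoetherianRing R] [CommRing S] [Algebra R S] [Module.Finite R S]
    {A : Ideal R} {B : Ideal S} (h : A.map (algebraMap R S) ≤
      B ⊔ (maximalIdeal R * A).map (algebraMap R S)) : A.map (algebraMap R S) ≤ B := by
  have hfg : (Submodule.restrictScalars R (A.map (algebraMap R S))).FG :=
    have := isNoetherian_of_isNoetherianRing_of_finite R S
    IsNoetherian.noetherian _
  refine Submodule.le_of_le_smul_of_le_jacobson_bot (I := maximalIdeal R)
    (N := Submodule.restrictScalars R B) hfg (jacobson_eq_maximalIdeal ⊥ bot_ne_top).ge ?_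
  rw [← Ideal.smul_restrictScalars, ← Submodule.restrictScalars_sup, smul_eq_mul, ← Ideal.map_mul]
  exact h

theorem Ideal.mem_nonZeroDivisors_of_map_pow_eq {R S : Type*} [CommRing R]
    [CommRing S] [Algebra R S] [Module.Flat R S] {I : Ideal R} {z : R} (hz : z ∈ I)
    (hz' : z ∈ nonZeroDivisors R) {y : S} {n : ℕ} {B : Ideal S}
    (h : Ideal.span {y} * B = (I ^ n).map (algebraMap R S)) : y ∈ nonZeroDivisors S := by
  have hz1 : algebraMap R S (z ^ n) ∈ Ideal.span {y} := by
    have h1 := Ideal.mem_map_of_mem (algebraMap R S) (Ideal.pow_mem_pow hz n)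
    rw [← h] at h1
    exact Ideal.mul_le_left h1
  obtain ⟨b, hb⟩ := Ideal.mem_span_singleton.mp hz1
  have hz2 : algebraMap R S (z ^ n) ∈ nonZeroDivisors S := by
    rw [mem_nonZeroDivisors_iff_right]
    intro s hs
    refine Module.Flat.isSMulRegular_of_nonZeroDivisors (pow_mem hz' n) ?_
    simpa [Algebra.smul_def, mul_comm] using hs
  rw [hb] at hz2
  exact (mul_mem_nonZeroDivisors.mp hz2).1

open Polynomial in
/-- After a finite free extension, the powers of the maximal ideal of a local ring whose
Hilbert function is eventually constant become eventually principal multiples of each other. -/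
theorem IsLocalRing.exists_free_algebra_span_mul_map_pow_eq (R : Type u) [CommRing R]
    [IsLocalRing R] [IsNoetherianRing R] {z : R} (hz : z ∈ maximalIdeal R)
    (hz' : z ∈ nonZeroDivisors R) {e N : ℕ}
    (he : ∀ n ≥ N, Module.length R ((maximalIdeal R ^ n : Ideal R) ⧸
      (maximalIdeal R • ⊤ : Submodule R (maximalIdeal R ^ n : Ideal R))) = e) :
    ∃ (S : Type u) (_ : CommRing S) (_ : Algebra R S) (y : S),
      Module.Free R S ∧ Module.Finite R S ∧ Nontrivial S ∧ y ∈ nonZeroDivisors S ∧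
      y ∈ (maximalIdeal R).map (algebraMap R S) ∧ ∃ n ≥ N,
      Ideal.span {y} * (maximalIdeal R ^ n).map (algebraMap R S) =
        (maximalIdeal R ^ (n + 1)).map (algebraMap R S) := by
  obtain ⟨n₀, hn₀⟩ := (maximalIdeal R).exists_forall_mem_pow_of_mul_mem_pow_succ hz hz'
  obtain ⟨x, hx⟩ := (maximalIdeal R).fg_of_isNoetherianRing.exists_eq_span_range_coeff
  have hxI : x ∈ (maximalIdeal R).map C :=
    Ideal.mem_map_C_iff.mpr fun i ↦ hx ▸ Ideal.subset_span ⟨i, rfl⟩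
  obtain ⟨n, hnn, hnN⟩ : ∃ n, n₀ ≤ n ∧ N ≤ n := ⟨max n₀ N, le_max_left _ _, le_max_right _ _⟩
  obtain ⟨p, hp, hpg⟩ := exists_monic_mul_mem hn₀ hx hnn (he n hnN) (he (n + 1) (by omega))
  let f : R[X] := X * p + 1
  have hf : f.Monic := by
    refine (monic_X.mul hp).add_of_left ?_
    rw [degree_one, hp.degree_mul, degree_X, degree_eq_natDegree hp.ne_zero]
    norm_cast
    omega
  have hfdeg : f.natDegree ≠ 0 := by
    have : (X * p).natDegree = 1 + p.natDegree := by
      rw [monic_X.natDegree_mul hp, natDegree_X]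
    rw [natDegree_add_eq_left_of_natDegree_lt] <;> rw [this]
    · omega
    · rw [natDegree_one]; omega
  have hfree : Module.Free R (AdjoinRoot f) := hf.free_adjoinRoot
  have hfin : Module.Finite R (AdjoinRoot f) := hf.finite_adjoinRoot
  have hnt : Nontrivial (AdjoinRoot f) := by
    refine Ideal.Quotient.nontrivial_iff.mpr ?_
    rw [Ne, Ideal.span_singleton_eq_top]
    intro h
    rw [hf.isUnit_iff] at h
    simp [h] at hfdeg
  have hmap (J : Ideal R) : (J.map C).map (AdjoinRoot.mk f) =
      J.map (algebraMap R (AdjoinRoot f)) := by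
    rw [Ideal.map_map]
    rfl
  have heq : Ideal.span {AdjoinRoot.mk f x} *
      (maximalIdeal R ^ n).map (algebraMap R (AdjoinRoot f)) =
        (maximalIdeal R ^ (n + 1)).map (algebraMap R (AdjoinRoot f)) := by
    refine le_antisymm ?_ ?_
    · rw [pow_succ' _ n, Ideal.map_mul]
      refine Ideal.mul_mono_left ?_
      rw [Ideal.span_singleton_le_iff_mem, ← hmap]
      exact Ideal.mem_map_of_mem _ hxI
    · have hle : (maximalIdeal R ^ (n + 1)).map (algebraMap R (AdjoinRoot f)) ≤
          Ideal.span {AdjoinRoot.mk f x} *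
            (maximalIdeal R ^ n).map (algebraMap R (AdjoinRoot f)) ⊔
          (maximalIdeal R ^ (n + 2)).map (algebraMap R (AdjoinRoot f)) := by
        rw [Ideal.map_le_iff_le_comap]
        intro g hg
        have h1 := Ideal.mem_map_of_mem (AdjoinRoot.mk f) (hpg g hg)
        rw [Ideal.map_sup, Ideal.map_mul, Ideal.map_span, Set.image_singleton, hmap, hmap,
          map_mul] at h1
        have hunit : AdjoinRoot.mk f p * (-AdjoinRoot.mk f X) = 1 := by
          have : AdjoinRoot.mk f (X * p + 1) = 0 := AdjoinRoot.mk_self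
          rw [map_add, map_mul, map_one] at this
          linear_combination -this
        have h2 := Ideal.mul_mem_right (-AdjoinRoot.mk f X) _ h1
        rwa [mul_assoc, hunit, mul_one] at h2
      rw [pow_succ' _ (n + 1)] at hle
      exact map_le_of_le_sup_map_maximalIdeal_mul hle
  refine ⟨AdjoinRoot f, inferInstance, inferInstance, AdjoinRoot.mk f x, hfree, hfin, hnt,
    ?_, hmap (maximalIdeal R) ▸ Ideal.mem_map_of_mem _ hxI, n, hnN, heq⟩
  exact Ideal.mem_nonZeroDivisors_of_map_pow_eq hz hz' heq

theorem Module.length_quotient_eq_add {R M : Type*} [Ring R] [AddCommGroup M] [Module R M]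
    {N P : Submodule R M} (h : N ≤ P) :
    Module.length R (M ⧸ N) = Module.length R (M ⧸ P) +
      Module.length R (P ⧸ Submodule.comap P.subtype N) := by
  rw [add_comm]
  refine Module.length_eq_add_of_exact (Submodule.mapQ _ N P.subtype le_rfl) (Submodule.factor h)
    ?_ (Submodule.factor_surjective h) ?_
  · rw [← LinearMap.ker_eq_bot]
    exact Submodule.ker_liftQ_eq_bot' _ _ (by rw [LinearMap.ker_comp, Submodule.ker_mkQ])
  · intro q
    obtain ⟨a, rfl⟩ := Submodule.mkQ_surjective _ q
    change (Submodule.Quotient.mk a : M ⧸ P) = 0 ↔ _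
    rw [Submodule.Quotient.mk_eq_zero]
    constructor
    · intro ha
      exact ⟨Submodule.Quotient.mk ⟨a, ha⟩, rfl⟩
    · rintro ⟨b, hb⟩
      obtain ⟨b, rfl⟩ := Submodule.mkQ_surjective _ b
      have hb' : (b : M) - a ∈ N := (Submodule.Quotient.eq N).mp hb
      have := P.sub_mem b.2 (h hb')
      simpa using this

theorem Submodule.eq_of_le_of_length_quotient_le {R M : Type*} [Ring R] [AddCommGroup M]
    [Module R M] {N P : Submodule R M} (h : N ≤ P)
    (hle : Module.length R (M ⧸ N) ≤ Module.length R (M ⧸ P))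
    (hfin : Module.length R (M ⧸ P) ≠ ⊤) : N = P := by
  refine le_antisymm h fun a ha ↦ ?_
  rw [Module.length_quotient_eq_add h] at hle
  have h0 : Module.length R (P ⧸ Submodule.comap P.subtype N) = 0 := by
    generalize Module.length R (P ⧸ Submodule.comap P.subtype N) = t at hle
    generalize Module.length R (M ⧸ P) = s at hle hfin
    lift s to ℕ using hfin
    have ht : t ≠ ⊤ := by
      rintro rfl
      simp at hle
    lift t to ℕ using ht
    norm_cast at hle ⊢
    omega
  rw [Module.length_eq_zero_iff, Submodule.Quotient.subsingleton_iff] at h0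
  have : (⟨a, ha⟩ : P) ∈ Submodule.comap P.subtype N := h0 ▸ trivial
  exact this

theorem Ideal.length_quotient_mul {R : Type*} [CommRing R] (I A : Ideal R) :
    Module.length R (R ⧸ I * A) =
      Module.length R (R ⧸ A) + Module.length R (A ⧸ (I • ⊤ : Submodule R A)) := by
  rw [Module.length_quotient_eq_add (N := I * A) (P := A) Ideal.mul_le_right,
    Ideal.smul_top_eq_comap_subtype]

theorem Ideal.length_quotient_span_singleton_mul (R : Type*) {S : Type*} [CommRing R] [CommRing S]
    [Algebra R S] {y : S} (hy : y ∈ nonZeroDivisors S) (B : Ideal S) :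
    Module.length R (S ⧸ Ideal.span {y} * B) =
      Module.length R (S ⧸ B) + Module.length R (S ⧸ Ideal.span {y}) := by
  have hle : Ideal.span {y} * B ≤ Ideal.span {y} := Ideal.mul_le_left
  let f : (S ⧸ B) →ₗ[S] (S ⧸ Ideal.span {y} * B) :=
    Submodule.mapQ _ _ (LinearMap.mulLeft S y) fun b hb ↦
      Ideal.mul_mem_mul (Ideal.mem_span_singleton_self y) hb
  let g : (S ⧸ Ideal.span {y} * B) →ₗ[S] (S ⧸ Ideal.span {y}) :=
    Submodule.factor hle
  have hg : Function.Surjective g := Submodule.factor_surjective hle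
  refine Module.length_eq_add_of_exact (f.restrictScalars R) (g.restrictScalars R) ?_
    hg ?_
  · change Function.Injective f
    rw [← LinearMap.ker_eq_bot, LinearMap.ker_eq_bot']
    intro q hq
    obtain ⟨a, rfl⟩ := Submodule.mkQ_surjective _ q
    have hq' : y * a ∈ Ideal.span {y} * B := (Submodule.Quotient.mk_eq_zero _).mp hq
    obtain ⟨b, hb, hba⟩ := Ideal.mem_span_singleton_mul.mp hq'
    rw [(mul_cancel_left_mem_nonZeroDivisors hy).mp hba] at hb
    exact (Submodule.Quotient.mk_eq_zero _).mpr hb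
  · intro q
    obtain ⟨a, rfl⟩ := Submodule.mkQ_surjective _ q
    change (Submodule.Quotient.mk a : S ⧸ Ideal.span {y}) = 0 ↔ _
    rw [Submodule.Quotient.mk_eq_zero, Ideal.mem_span_singleton]
    constructor
    · rintro ⟨b, rfl⟩
      exact ⟨Submodule.Quotient.mk b, rfl⟩
    · rintro ⟨b, hb⟩
      obtain ⟨b, rfl⟩ := Submodule.mkQ_surjective _ b
      have hb' : y * b - a ∈ Ideal.span {y} * B := (Submodule.Quotient.eq _).mp hb
      have := Ideal.mem_span_singleton.mp (Ideal.mul_le_left hb')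
      exact (dvd_sub_right (Dvd.intro b rfl)).mp this

open TensorProduct in
theorem Ideal.length_quotient_map {R S : Type*} [CommRing R] [Nontrivial R] [CommRing S]
    [Algebra R S] [Module.Free R S] [Module.Finite R S] (J : Ideal R) :
    Module.length R (S ⧸ J.map (algebraMap R S)) =
      Module.finrank R S * Module.length R (R ⧸ J) := by
  let b := Module.finBasis R S
  have h1 : Module.length R (S ⧸ J.map (algebraMap R S)) =
      Module.length R (S ⧸ (J • ⊤ : Submodule R S)) := by
    rw [Ideal.smul_top_eq_map]
    exact (Submodule.Quotient.restrictScalarsEquiv R _).symm.length_eq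
  rw [h1, ← (TensorProduct.quotTensorEquivQuotSMul S J).length_eq,
    (TensorProduct.congr (LinearEquiv.refl R (R ⧸ J)) b.equivFun ≪≫ₗ
      TensorProduct.piScalarRight R R (R ⧸ J) (Fin (Module.finrank R S))).length_eq,
    Module.length_pi, ENat.card_eq_coe_fintype_card, Fintype.card_fin]

theorem IsLocalRing.length_smul_top_ne_top {R : Type*} [CommRing R] [IsLocalRing R]
    [IsNoetherianRing R] (A : Ideal R) :
    Module.length R (A ⧸ (maximalIdeal R • ⊤ : Submodule R A)) ≠ ⊤ := by
  let _ := Ideal.Quotient.field (maximalIdeal R)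
  have : Module.Finite (R ⧸ maximalIdeal R) (A ⧸ (maximalIdeal R • ⊤ : Submodule R A)) :=
    Module.Finite.of_restrictScalars_finite R _ _
  rw [Module.length_eq_of_surjective (R := R ⧸ maximalIdeal R) Ideal.Quotient.mk_surjective,
    Module.length_eq_finrank]
  exact ENat.natCast_ne_top _

theorem IsLocalRing.length_quotient_ne_top {R : Type*} [CommRing R] [IsLocalRing R]
    [IsNoetherianRing R] {A : Ideal R} {k : ℕ} (h : maximalIdeal R ^ k ≤ A) :
    Module.length R (R ⧸ A) ≠ ⊤ := by
  have hk : Module.length R (R ⧸ maximalIdeal R ^ k) ≠ ⊤ := by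
    clear h
    induction k with
    | zero =>
      rw [pow_zero, Module.length_eq_zero_iff.mpr]
      · simp
      · exact Submodule.Quotient.subsingleton_iff.mpr Ideal.one_eq_top
    | succ k ih =>
      rw [pow_succ', Ideal.length_quotient_mul]
      exact WithTop.add_ne_top.mpr ⟨ih, length_smul_top_ne_top _⟩
  exact ne_top_of_le_ne_top hk (Module.length_le_of_surjective _ (Submodule.factor_surjective h))

theorem IsLocalRing.length_smul_top_le_and_eq {R S : Type*} [CommRing R] [IsLocalRing R]
    [IsNoetherianRing R] [CommRing S] [Algebra R S] [Module.Free R S] [Module.Finite R S]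
    [Nontrivial S] {y : S} (hy : y ∈ nonZeroDivisors S)
    (hym : y ∈ (maximalIdeal R).map (algebraMap R S)) {n e : ℕ}
    (heq : Ideal.span {y} * (maximalIdeal R ^ n).map (algebraMap R S) =
        (maximalIdeal R ^ (n + 1)).map (algebraMap R S))
    (he : Module.length R ((maximalIdeal R ^ n : Ideal R) ⧸
      (maximalIdeal R • ⊤ : Submodule R (maximalIdeal R ^ n : Ideal R))) = e)
    {J : Ideal R} (hJ : Module.length R (R ⧸ J) ≠ ⊤) :
    Module.length R (J ⧸ (maximalIdeal R • ⊤ : Submodule R J)) ≤ e ∧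
    (Module.length R (J ⧸ (maximalIdeal R • ⊤ : Submodule R J)) = e →
      Module.length R ((maximalIdeal R * J : Ideal R) ⧸
        (maximalIdeal R • ⊤ : Submodule R (maximalIdeal R * J : Ideal R))) = e) := by
  have hd : 0 < Module.finrank R S := by
    rw [Module.finrank_eq_card_basis (Module.finBasis R S), Fintype.card_pos_iff]
    exact (Module.finBasis R S).index_nonempty
  -- the colength of `y` is `finrank R S * e`
  have hL : Module.length R (S ⧸ Ideal.span {y}) = (Module.finrank R S * e : ℕ) := by
    have h1 := Ideal.length_quotient_span_singleton_mul R hy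
      ((maximalIdeal R ^ n).map (algebraMap R S))
    rw [heq, Ideal.length_quotient_map, Ideal.length_quotient_map, pow_succ',
      Ideal.length_quotient_mul, he] at h1
    have h2 := length_quotient_ne_top (le_refl (maximalIdeal R ^ n))
    generalize Module.length R (R ⧸ maximalIdeal R ^ n) = a at h1 h2
    generalize Module.length R (S ⧸ Ideal.span {y}) = L at h1 ⊢
    lift a to ℕ using h2
    rw [mul_add] at h1
    have := (WithTop.add_left_inj (x := ((Module.finrank R S * a : ℕ) : ℕ∞))
      (ENat.natCast_ne_top _)).mp (by push_cast; exact h1)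
    rw [← this]
    push_cast
    rfl
  have hymul (A : Ideal R) : Module.length R (S ⧸ Ideal.span {y} * A.map (algebraMap R S)) =
      Module.finrank R S * Module.length R (R ⧸ A) + (Module.finrank R S * e : ℕ) := by
    rw [Ideal.length_quotient_span_singleton_mul R hy, Ideal.length_quotient_map, hL]
  have hle : Ideal.span {y} * J.map (algebraMap R S) ≤
      (maximalIdeal R * J).map (algebraMap R S) := by
    rw [Ideal.map_mul]
    exact Ideal.mul_mono_left ((Ideal.span_singleton_le_iff_mem _).mpr hym)
  have hmJ := Ideal.length_quotient_mul (maximalIdeal R) J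
  have hmJS := Ideal.length_quotient_map (S := S) (maximalIdeal R * J)
  have hmmJ := Ideal.length_quotient_mul (maximalIdeal R) (maximalIdeal R * J)
  have hmmJS := Ideal.length_quotient_map (S := S) (maximalIdeal R * (maximalIdeal R * J))
  have hμ := length_smul_top_ne_top J
  have hμ' := length_smul_top_ne_top (maximalIdeal R * J)
  obtain ⟨a, ha⟩ := ENat.ne_top_iff_exists.mp hJ
  obtain ⟨b, hb⟩ := ENat.ne_top_iff_exists.mp hμ
  obtain ⟨c, hc⟩ := ENat.ne_top_iff_exists.mp hμ'
  have hyJ := hymul J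
  have hymJ := hymul (maximalIdeal R * J)
  rw [← ha, ← hb] at hmJ
  rw [hmJ] at hmJS hymJ hmmJ
  rw [← hc] at hmmJ ⊢
  rw [hmmJ] at hmmJS
  rw [← ha] at hyJ
  rw [← hb]
  norm_cast at hyJ hymJ hmJS hmmJS ⊢
  constructor
  · have := Module.length_le_of_surjective ((Submodule.factor hle).restrictScalars R)
      (Submodule.factor_surjective hle)
    rw [hyJ, hmJS] at this
    norm_cast at this
    rw [mul_add] at this
    exact Nat.le_of_mul_le_mul_left (by omega) hd
  · rintro rfl
    have hS : Ideal.span {y} * J.map (algebraMap R S) =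
        (maximalIdeal R * J).map (algebraMap R S) := by
      have := Submodule.eq_of_le_of_length_quotient_le
        (N := (Ideal.span {y} * J.map (algebraMap R S)).restrictScalars R)
        (P := ((maximalIdeal R * J).map (algebraMap R S)).restrictScalars R) hle ?_ ?_
      · exact Submodule.restrictScalars_injective R S S this
      · rw [(Submodule.Quotient.restrictScalarsEquiv R _).length_eq,
          (Submodule.Quotient.restrictScalarsEquiv R _).length_eq, hyJ, hmJS, mul_add]
      · rw [(Submodule.Quotient.restrictScalarsEquiv R _).length_eq, hmJS]
        exact ENat.natCast_ne_top _
    have hS' : Ideal.span {y} * (maximalIdeal R * J).map (algebraMap R S) =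
        (maximalIdeal R * (maximalIdeal R * J)).map (algebraMap R S) := by
      calc
        _ = (maximalIdeal R).map (algebraMap R S) *
            (Ideal.span {y} * J.map (algebraMap R S)) := by rw [Ideal.map_mul, mul_left_comm]
        _ = _ := by rw [hS, ← Ideal.map_mul]
    rw [hS', hmmJS] at hymJ
    norm_cast at hymJ
    rw [← mul_add] at hymJ
    have := Nat.eq_of_mul_eq_mul_left hd hymJ
    omega

/-- The restriction map `M ≃ Hom(R, M) → Hom(A, M)`. -/
def Ideal.restrictHom {R : Type*} [CommRing R] (A : Ideal R) (M : Type*) [AddCommGroup M]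
    [Module R M] : M →ₗ[R] A →ₗ[R] M :=
  (LinearMap.lcomp R M A.subtype).comp (LinearMap.ringLmapEquivSelf R R M).symm.toLinearMap

theorem Ideal.restrictHom_apply {R : Type*} [CommRing R] (A : Ideal R) {M : Type*}
    [AddCommGroup M] [Module R M] (m : M) (a : A) : A.restrictHom M m a = (a : R) • m := rfl

theorem Ideal.exists_surjective_ker_lcomp_restrictHom {R : Type*} [CommRing R] (A : Ideal R)
    {M P₀ P₁ P₂ : Type*} [AddCommGroup M] [Module R M] [AddCommGroup P₀] [Module R P₀]
    [AddCommGroup P₁] [Module R P₁] [AddCommGroup P₂] [Module R P₂] [Module.Projective R P₀]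
    {d₂ : P₂ →ₗ[R] P₁} {d₁ : P₁ →ₗ[R] P₀} {ε : P₀ →ₗ[R] R ⧸ A}
    (h₁ : Function.Exact d₂ d₁) (h₀ : Function.Exact d₁ ε) (hε : Function.Surjective ε) :
    ∃ Θ : LinearMap.ker (LinearMap.lcomp R M d₂) →ₗ[R]
        (A →ₗ[R] M) ⧸ LinearMap.range (A.restrictHom M),
      Function.Surjective Θ ∧ ∀ φ, Θ φ = 0 ↔ φ.1 ∈ LinearMap.range (LinearMap.lcomp R M d₁) := by
  obtain ⟨u, hu⟩ := hε 1
  obtain ⟨τ, hτ⟩ := Module.projective_lifting_property (Submodule.mkQ A) ε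
    (Submodule.mkQ_surjective A)
  have hτ' (p : P₀) : Ideal.Quotient.mk A (τ p) = ε p := DFunLike.congr_fun hτ p
  have hτd (p : P₁) : τ (d₁ p) ∈ A := by
    rw [← Ideal.Quotient.eq_zero_iff_mem, hτ', h₀.apply_apply_eq_zero]
  have hεu (r : R) : ε (r • u) = Ideal.Quotient.mk A r := by
    rw [map_smul, hu]
    exact congrArg (Ideal.Quotient.mk A) (mul_one r)
  have hmem (a : A) : (a : R) • u ∈ LinearMap.range d₁ := by
    refine (h₀ _).mp ?_
    rw [hεu, Ideal.Quotient.eq_zero_iff_mem]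
    exact a.2
  -- a cocycle descends to the image of `d₁`
  let E : LinearMap.range d₁ →ₗ[R] P₁ ⧸ LinearMap.ker d₁ := d₁.quotKerEquivRange.symm.toLinearMap
  have hker (φ : LinearMap.ker (LinearMap.lcomp R M d₂)) : LinearMap.ker d₁ ≤ LinearMap.ker φ.1 := by
    intro p hp
    obtain ⟨q, rfl⟩ := (h₁ p).mp hp
    exact DFunLike.congr_fun (LinearMap.mem_ker.mp φ.2) q
  let D (φ : LinearMap.ker (LinearMap.lcomp R M d₂)) : LinearMap.range d₁ →ₗ[R] M :=
    ((LinearMap.ker d₁).liftQ φ.1 (hker φ)).comp E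
  have hD (φ) (p : P₁) (hp : d₁ p ∈ LinearMap.range d₁) : D φ ⟨d₁ p, hp⟩ = φ.1 p := by
    have : E ⟨d₁ p, hp⟩ = Submodule.Quotient.mk p := by
      refine (LinearEquiv.symm_apply_eq _).mpr ?_
      ext
      simp
    change (LinearMap.ker d₁).liftQ φ.1 (hker φ) (E _) = _
    rw [this]
    rfl
  let ι : A →ₗ[R] LinearMap.range d₁ :=
    LinearMap.codRestrict _ ((LinearMap.toSpanSingleton R P₀ u).comp A.subtype) hmem
  let Θ : LinearMap.ker (LinearMap.lcomp R M d₂) →ₗ[R] A →ₗ[R] M :=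
    { toFun φ := (D φ).comp ι
      map_add' φ φ' := by
        ext a
        obtain ⟨p, hp⟩ := hmem a
        have : ι a = ⟨d₁ p, LinearMap.mem_range_self d₁ p⟩ := Subtype.ext hp.symm
        simp [this, hD]
      map_smul' c φ := by
        ext a
        obtain ⟨p, hp⟩ := hmem a
        have : ι a = ⟨d₁ p, LinearMap.mem_range_self d₁ p⟩ := Subtype.ext hp.symm
        simp [this, hD] }
  have hΘ (φ) (a : A) (p : P₁) (h : d₁ p = (a : R) • u) : Θ φ a = φ.1 p := by
    have : ι a = ⟨d₁ p, LinearMap.mem_range_self d₁ p⟩ := Subtype.ext h.symm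
    change D φ (ι a) = _
    rw [this, hD]
  refine ⟨(Submodule.mkQ _).comp Θ, ?_, ?_⟩
  · intro q
    obtain ⟨ψ, rfl⟩ := Submodule.mkQ_surjective _ q
    have hb : τ u - 1 ∈ A := by
      rw [← Ideal.Quotient.eq_zero_iff_mem, map_sub, hτ', hu, map_one, sub_self]
    refine ⟨⟨ψ.comp (LinearMap.codRestrict A (τ.comp d₁) hτd), ?_⟩, ?_⟩
    · ext q
      have : LinearMap.codRestrict A (τ.comp d₁) hτd (d₂ q) = 0 := by
        ext
        simp [h₁.apply_apply_eq_zero]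
      change ψ (LinearMap.codRestrict A (τ.comp d₁) hτd (d₂ q)) = 0
      rw [this, map_zero]
    · refine (Submodule.Quotient.eq _).mpr ⟨ψ ⟨τ u - 1, hb⟩, ?_⟩
      ext a
      obtain ⟨p, hp⟩ := hmem a
      rw [LinearMap.sub_apply, hΘ _ a p hp, Ideal.restrictHom_apply, ← map_smul, eq_sub_iff_add_eq,
        ← map_add]
      change ψ _ = ψ ⟨τ (d₁ p), _⟩
      congr 1
      ext
      simp [hp]
      ring
  · intro φ
    change Submodule.Quotient.mk (Θ φ) = _ ↔ _
    rw [Submodule.Quotient.mk_eq_zero]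
    constructor
    · rintro ⟨m, hm⟩
      have hπ (p : P₀) : (LinearMap.id - τ.smulRight u : P₀ →ₗ[R] P₀) p ∈ LinearMap.range d₁ := by
        refine (h₀ _).mp ?_
        change ε (p - τ p • u) = 0
        rw [map_sub, hεu, hτ', sub_self]
      refine ⟨τ.smulRight m + (D φ).comp (LinearMap.codRestrict _ _ hπ), ?_⟩
      ext p
      obtain ⟨q, hq⟩ := hmem ⟨_, hτd p⟩
      have h2 := hΘ φ ⟨_, hτd p⟩ q hq
      rw [← hm, Ideal.restrictHom_apply] at h2
      have h3 : LinearMap.codRestrict _ _ hπ (d₁ p) = ⟨d₁ (p - q), LinearMap.mem_range_self d₁ _⟩ := by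
        ext
        simp [hq]
      change τ (d₁ p) • m + D φ (LinearMap.codRestrict _ _ hπ (d₁ p)) = φ.1 p
      rw [h3, hD, map_sub, ← h2]
      abel
    · rintro ⟨h, hh⟩
      refine ⟨h u, ?_⟩
      ext a
      obtain ⟨p, hp⟩ := hmem a
      rw [hΘ φ a p hp, ← hh, Ideal.restrictHom_apply, ← map_smul, ← hp]
      rfl

theorem CategoryTheory.ShortComplex.nonempty_homology_equiv {R : Type*} [Ring R]
    (S : ShortComplex (ModuleCat.{u} R)) {Q : Type*} [AddCommGroup Q] [Module R Q]
    (Θ : LinearMap.ker S.g.hom →ₗ[R] Q) (hs : Function.Surjective Θ)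
    (hk : ∀ φ, Θ φ = 0 ↔ φ.1 ∈ LinearMap.range S.f.hom) :
    Nonempty (S.homology ≃ₗ[R] Q) := by
  have h : LinearMap.range S.moduleCatToCycles = LinearMap.ker Θ := by
    ext φ
    rw [LinearMap.mem_ker, hk]
    exact ⟨fun ⟨a, ha⟩ ↦ ⟨a, congrArg Subtype.val ha⟩, fun ⟨a, ha⟩ ↦ ⟨a, Subtype.ext ha⟩⟩
  exact ⟨S.moduleCatHomologyIso.toLinearEquiv ≪≫ₗ Submodule.quotEquivOfEq _ _ h ≪≫ₗ
    Θ.quotKerEquivOfSurjective hs⟩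

theorem Ideal.nonempty_ext_one_equiv {R : Type u} [CommRing R] (A : Ideal R)
    (M : ModuleCat.{u} R) :
    Nonempty (((_root_.Ext R (ModuleCat.{u} R) 1).obj (Opposite.op (ModuleCat.of R (R ⧸ A)))).obj M
      ≃ₗ[R] (A →ₗ[R] M) ⧸ LinearMap.range (A.restrictHom M)) := by
  let P := projectiveResolution (ModuleCat.of R (R ⧸ A))
  have : Module.Projective R (P.complex.X 0) :=
    (IsProjective.iff_projective (R := R) (P := P.complex.X 0)).mpr (P.projective 0)
  have h₁ : Function.Exact (P.complex.d 2 1).hom (P.complex.d 1 0).hom :=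
    (ShortComplex.ShortExact.moduleCat_exact_iff_function_exact _).mp (P.exact_succ 0)
  have h₀ : Function.Exact (P.complex.d 1 0).hom (P.π.f 0).hom :=
    (ShortComplex.ShortExact.moduleCat_exact_iff_function_exact _).mp P.exact₀
  have hε : Function.Surjective (P.π.f 0).hom :=
    (ModuleCat.epi_iff_surjective (P.π.f 0)).mp inferInstance
  obtain ⟨Θ, hs, hk⟩ := Ideal.exists_surjective_ker_lcomp_restrictHom A (M := M) h₁ h₀ hε
  let K := P.complex.linearYonedaObj R M
  let S := K.sc' 0 1 2
  let e : LinearMap.ker S.g.hom ≃ₗ[R] LinearMap.ker (LinearMap.lcomp R M (P.complex.d 2 1).hom) :=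
    { toFun φ := ⟨ModuleCat.Hom.hom (show P.complex.X 1 ⟶ M from φ.1),
        congrArg ModuleCat.Hom.hom (show P.complex.d 2 1 ≫ (show P.complex.X 1 ⟶ M from φ.1) = 0
          from φ.2)⟩
      invFun φ := ⟨(ModuleCat.ofHom φ.1 : P.complex.X 1 ⟶ M),
        show P.complex.d 2 1 ≫ (ModuleCat.ofHom φ.1 : P.complex.X 1 ⟶ M) = 0 from
          ModuleCat.hom_ext φ.2⟩
      map_add' φ ψ := rfl
      map_smul' c φ := rfl
      left_inv φ := rfl
      right_inv φ := rfl }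
  obtain ⟨f⟩ := S.nonempty_homology_equiv (Θ.comp e.toLinearMap) (hs.comp e.surjective) fun φ ↦ by
    refine (hk _).trans ⟨fun ⟨h, hh⟩ ↦ ⟨(ModuleCat.ofHom h : P.complex.X 0 ⟶ M), ?_⟩,
      fun ⟨h, hh⟩ ↦ ⟨ModuleCat.Hom.hom (show P.complex.X 0 ⟶ M from h), ?_⟩⟩
    · exact ModuleCat.hom_ext hh
    · exact congrArg ModuleCat.Hom.hom hh
  exact ⟨(P.isoExt (R := R) 1 M ≪≫ K.homologyIsoSc' 0 1 2 (by simp) (by simp)).toLinearEquiv ≪≫ₗ f⟩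

theorem Module.length_le_of_surjective_of_ker_le {R N H T : Type*} [Ring R] [AddCommGroup N]
    [Module R N] [AddCommGroup H] [Module R H] [AddCommGroup T] [Module R T] {g : N →ₗ[R] H}
    (hg : Function.Surjective g) {f : N →ₗ[R] T} (h : LinearMap.ker f ≤ LinearMap.ker g) :
    Module.length R H ≤ Module.length R T :=
  calc
    _ ≤ Module.length R (N ⧸ LinearMap.ker f) :=
      Module.length_le_of_surjective ((LinearMap.ker f).liftQ g h) fun q ↦
        (hg q).elim fun a ha ↦ ⟨Submodule.Quotient.mk a, ha⟩
    _ = Module.length R (LinearMap.range f) := f.quotKerEquivRange.length_eq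
    _ ≤ _ := Module.length_le_of_injective _ (LinearMap.range f).injective_subtype

theorem Ideal.length_hom_quotient_le {R : Type*} [CommRing R] {A I : Ideal R} {x : R} (hxA : x ∈ A)
    (hx : x ∈ nonZeroDivisors R) :
    Module.length R (R ⧸ A →ₗ[R] R ⧸ I) ≤
      Module.length R ((A →ₗ[R] I) ⧸ LinearMap.range (A.restrictHom I)) := by
  let N : Ideal R := Submodule.colon I (A : Set R)
  have hN (r : N) (a : A) : (r : R) * a ∈ I := Submodule.mem_colon.mp r.2 a a.2
  let g : N →ₗ[R] R ⧸ A →ₗ[R] R ⧸ I :=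
    { toFun r := A.liftQ (LinearMap.toSpanSingleton R (R ⧸ I) (Submodule.Quotient.mk r)) fun a ha ↦
        (Submodule.Quotient.mk_eq_zero I).mpr (by simpa [mul_comm] using hN r ⟨a, ha⟩)
      map_add' r s := Submodule.linearMap_qext _ <| LinearMap.ext_ring <|
        smul_add (1 : R) (Submodule.Quotient.mk (r : R) : R ⧸ I) (Submodule.Quotient.mk (s : R))
      map_smul' c r := Submodule.linearMap_qext _ <| LinearMap.ext_ring <|
        smul_comm (1 : R) c (Submodule.Quotient.mk (r : R) : R ⧸ I) }
  let f : N →ₗ[R] A →ₗ[R] I :=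
    { toFun r := LinearMap.codRestrict I ((LinearMap.mulLeft R (r : R)).comp A.subtype) (hN r)
      map_add' r s := LinearMap.ext fun a ↦ Subtype.ext (add_mul (r : R) s a)
      map_smul' c r := LinearMap.ext fun a ↦ Subtype.ext (mul_assoc c (r : R) a) }
  have hg1 (r : N) : g r 1 = Submodule.Quotient.mk (r : R) :=
    one_smul R (Submodule.Quotient.mk (r : R) : R ⧸ I)
  refine Module.length_le_of_surjective_of_ker_le (g := g) (f := (Submodule.mkQ _).comp f) ?_ ?_
  · intro ψ
    obtain ⟨r, hr⟩ := Submodule.mkQ_surjective _ (ψ 1)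
    have hrN : r ∈ N := Submodule.mem_colon.mpr fun a ha ↦ by
      rw [smul_eq_mul, mul_comm, ← smul_eq_mul, ← Submodule.Quotient.mk_eq_zero I,
        Submodule.Quotient.mk_smul]
      change a • Submodule.mkQ I r = 0
      rw [hr, ← map_smul]
      have : a • (1 : R ⧸ A) = 0 :=
        (Submodule.Quotient.mk_eq_zero A).mpr (show a * 1 ∈ A by rwa [mul_one])
      rw [this, map_zero]
    refine ⟨⟨r, hrN⟩, Submodule.linearMap_qext _ (LinearMap.ext_ring ?_)⟩
    exact (hg1 _).trans hr
  · intro r hr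
    obtain ⟨i, hi⟩ := (Submodule.Quotient.mk_eq_zero _).mp (LinearMap.mem_ker.mp hr)
    have hxi : x * (i : R) = r * x := by
      have := DFunLike.congr_fun hi ⟨x, hxA⟩
      exact congrArg Subtype.val this
    rw [mul_comm, mul_cancel_right_mem_nonZeroDivisors hx] at hxi
    refine LinearMap.mem_ker.mpr (Submodule.linearMap_qext _ (LinearMap.ext_ring ?_))
    exact (hg1 r).trans ((Submodule.Quotient.mk_eq_zero _).mpr (hxi ▸ i.2))

theorem Ideal.length_hom_quotient_range_restrictHom_le {R : Type*} [CommRing R] {A I : Ideal R}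
    {x : R} (hxA : x ∈ A) (hx : x ∈ nonZeroDivisors R) :
    Module.length R ((A →ₗ[R] I) ⧸ LinearMap.range (A.restrictHom I)) ≤
      Module.length R (Submodule.colon (Ideal.span {x} * I) (A : Set R) ⧸ Submodule.comap
        (Submodule.subtype (Submodule.colon (Ideal.span {x} * I) (A : Set R)))
        (Ideal.span {x} * I)) := by
  have hψ (ψ : A →ₗ[R] I) (a : A) : (a : R) * ψ ⟨x, hxA⟩ = x * ψ a := by
    have h : (a : R) • ψ ⟨x, hxA⟩ = x • ψ a := by
      rw [← map_smul, ← map_smul]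
      congr 1
      ext
      exact mul_comm _ _
    exact congrArg Subtype.val h
  let f : (A →ₗ[R] I) →ₗ[R] Submodule.colon (Ideal.span {x} * I) (A : Set R) :=
    LinearMap.codRestrict _ (I.subtype.comp (LinearMap.applyₗ ⟨x, hxA⟩)) fun ψ ↦
      Submodule.mem_colon.mpr fun a ha ↦ by
        change (ψ ⟨x, hxA⟩ : R) * a ∈ _
        rw [mul_comm _ a, hψ ψ ⟨a, ha⟩]
        exact Ideal.mul_mem_mul (Ideal.mem_span_singleton_self x) (ψ ⟨a, ha⟩).2
  refine Module.length_le_of_surjective_of_ker_le (f := (Submodule.mkQ _).comp f)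
    (Submodule.mkQ_surjective _) fun ψ h ↦ ?_
  have h' : (ψ ⟨x, hxA⟩ : R) ∈ Ideal.span {x} * I :=
    (Submodule.Quotient.mk_eq_zero (Submodule.comap _ _)).mp (LinearMap.mem_ker.mp h)
  obtain ⟨i, hi, hix⟩ := Ideal.mem_span_singleton_mul.mp h'
  refine LinearMap.mem_ker.mpr ((Submodule.Quotient.mk_eq_zero _).mpr ⟨⟨i, hi⟩, ?_⟩)
  ext a
  change (a : R) * i = ψ a
  rw [← mul_cancel_left_mem_nonZeroDivisors hx, ← hψ, ← hix]
  ring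

theorem IsLocalRing.maximalIdeal_le_radical_span_singleton {R : Type*} [CommRing R] [IsLocalRing R]
    (hdim : ringKrullDim R ≤ 1) {x : R} (hx : x ∈ nonZeroDivisors R) :
    maximalIdeal R ≤ (Ideal.span {x}).radical := by
  have h0 : Ring.KrullDimLE 0 (R ⧸ Ideal.span {x}) := by
    rw [Ring.krullDimLE_iff]
    have h := (ringKrullDim_quotient_succ_le_of_nonZeroDivisor hx).trans hdim
    generalize ringKrullDim (R ⧸ Ideal.span {x}) = d at h ⊢
    induction d using WithBot.recBotCoe with
    | bot => exact bot_le
    | coe d =>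
      induction d using ENat.recTopCoe with
      | top => exact absurd h (by decide)
      | coe d =>
        norm_cast at h ⊢
        omega
  rw [Ideal.radical_eq_sInf]
  refine le_sInf fun p ⟨hp, hprime⟩ ↦ ?_
  have hker : RingHom.ker (Ideal.Quotient.mk (Ideal.span {x})) ≤ p := by
    rwa [Ideal.mk_ker]
  have := Ideal.map_isPrime_of_surjective Ideal.Quotient.mk_surjective hker
  have hmax := Ideal.isMaximal_of_isPrime (p.map (Ideal.Quotient.mk (Ideal.span {x})))
  have hc := Ideal.comap_isMaximal_of_surjective (Ideal.Quotient.mk (Ideal.span {x}))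
    Ideal.Quotient.mk_surjective (K := p.map (Ideal.Quotient.mk (Ideal.span {x})))
  rw [Ideal.comap_map_of_surjective' _ Ideal.Quotient.mk_surjective, sup_eq_left.mpr hker] at hc
  exact (eq_maximalIdeal hc).ge

theorem IsLocalRing.length_colon_lt {R : Type u} [CommRing R] [IsLocalRing R] [IsNoetherianRing R]
    {x : R} (hxm : x ∈ maximalIdeal R) (hx : x ∈ nonZeroDivisors R) {e N k : ℕ}
    (he : ∀ n ≥ N, Module.length R ((maximalIdeal R ^ n : Ideal R) ⧸
      (maximalIdeal R • ⊤ : Submodule R (maximalIdeal R ^ n : Ideal R))) = e)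
    {I : Ideal R} (hk : maximalIdeal R ^ k ≤ Ideal.span {x} * I)
    (hI : Module.length R (I ⧸ (maximalIdeal R • ⊤ : Submodule R I)) ≠ e) :
    Module.length R (Submodule.colon (Ideal.span {x} * I) (maximalIdeal R : Set R) ⧸
      Submodule.comap (Submodule.subtype (Submodule.colon (Ideal.span {x} * I)
        (maximalIdeal R : Set R))) (Ideal.span {x} * I)) < e := by
  set J : Ideal R := Submodule.colon (Ideal.span {x} * I) (maximalIdeal R : Set R)
  have hIJ : Ideal.span {x} * I ≤ J := fun r hr ↦ Submodule.mem_colon.mpr fun a _ ↦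
    Ideal.mul_mem_right a _ hr
  have hmJ : maximalIdeal R * J ≤ Ideal.span {x} * I := Ideal.mul_le.mpr fun a ha r hr ↦
    mul_comm a r ▸ Submodule.mem_colon.mp hr a ha
  have hxI : Module.length R (R ⧸ Ideal.span {x} * I) ≠ ⊤ := length_quotient_ne_top hk
  have hJfin : Module.length R (R ⧸ J) ≠ ⊤ := length_quotient_ne_top (hk.trans hIJ)
  have hxfin : Module.length R (R ⧸ Ideal.span {x}) ≠ ⊤ :=
    length_quotient_ne_top (hk.trans Ideal.mul_le_left)
  have hIfin : Module.length R (R ⧸ I) ≠ ⊤ := length_quotient_ne_top (hk.trans Ideal.mul_le_right)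
  obtain ⟨S, _, _, y, _, _, _, hy, hym, n, hn, heq⟩ :=
    exists_free_algebra_span_mul_map_pow_eq R hxm hx he
  obtain ⟨hle, hmu⟩ := length_smul_top_le_and_eq hy hym heq (he n hn) hJfin
  -- `μ(J)` bounds the colength of `xI` in `J`
  have h1 := Module.length_quotient_eq_add hIJ
  have h2 := Ideal.length_quotient_mul (maximalIdeal R) J
  have h3 : Module.length R (R ⧸ Ideal.span {x} * I) ≤ Module.length R (R ⧸ maximalIdeal R * J) :=
    Module.length_le_of_surjective _ (Submodule.factor_surjective hmJ)
  rw [h1, h2] at h3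
  have hle' := (WithTop.add_le_add_iff_left hJfin).mp h3
  refine lt_of_le_of_ne (hle'.trans hle) fun hte ↦ hI ?_
  have hμJ := le_antisymm hle (hte ▸ hle')
  have hEq : maximalIdeal R * J = Ideal.span {x} * I :=
    Submodule.eq_of_le_of_length_quotient_le hmJ (by rw [h1, h2, hte, hμJ]) hxI
  have hμ := hmu hμJ
  rw [hEq] at hμ
  -- multiplication by `x` preserves the number of generators
  have h4 := Ideal.length_quotient_mul (maximalIdeal R) (Ideal.span {x} * I)
  rw [mul_left_comm, Ideal.length_quotient_span_singleton_mul R hx,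
    Ideal.length_quotient_span_singleton_mul R hx, Ideal.length_quotient_mul, hμ,
    add_right_comm] at h4
  exact (WithTop.add_left_inj (WithTop.add_ne_top.mpr ⟨hIfin, hxfin⟩)).mp h4

theorem rlength_eq_coe_length (R : Type u) (M : Type*) [Ring R] [AddCommGroup M] [Module R M] :
    rlength R M = (Module.length R M : WithBot ℕ∞) :=
  (Module.coe_length R M).symm

theorem HasMultiplicity.exists_forall_length_eq {R : Type u} [CommRing R] [IsLocalRing R]
    [IsNoetherianRing R] {e : ℕ} (he : HasMultiplicity R e) :
    ∃ N : ℕ, ∀ n ≥ N, Module.length R ((maximalIdeal R ^ n : Ideal R) ⧸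
      (maximalIdeal R • ⊤ : Submodule R (maximalIdeal R ^ n : Ideal R))) = e := by
  obtain ⟨N, hN⟩ := he
  refine ⟨N, fun n hn ↦ ?_⟩
  have h := hN n hn
  rw [rlength_eq_coe_length, rlength_eq_coe_length, pow_succ', Ideal.length_quotient_mul] at h
  exact (WithTop.add_left_inj (length_quotient_ne_top le_rfl)).mp (WithBot.coe_injective h)

theorem elias_of_mu_lt_and_type_ge (R : Type u) [CommRing R] [IsLocalRing R] [IsNoetherianRing R]
    (hdim : ringKrullDim R = 1)
    (hCM : ∃ x ∈ maximalIdeal R, x ∈ nonZeroDivisors R)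
    (e : ℕ) (he : HasMultiplicity R e)
    (I : Ideal R) (hI : IsMPrimary R I)
    (hmu : mu R I < (e : WithBot ℕ∞))
    (htype : ((e - 1 : ℕ) : WithBot ℕ∞) ≤ quotType R I) :
    EliasIdeal R I := by
  obtain ⟨x, hxm, hx⟩ := hCM
  obtain ⟨N, hN⟩ := he.exists_forall_length_eq
  obtain ⟨a, ha⟩ := Ideal.exists_pow_le_of_le_radical_of_fg
    (maximalIdeal_le_radical_span_singleton hdim.le hx) (maximalIdeal R).fg_of_isNoetherianRing
  obtain ⟨b, hb⟩ := Ideal.exists_pow_le_of_le_radical_of_fg (I := maximalIdeal R) (J := I)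
    hI.ge (maximalIdeal R).fg_of_isNoetherianRing
  have hk : maximalIdeal R ^ (a + b) ≤ Ideal.span {x} * I := pow_add (maximalIdeal R) a b ▸
    Ideal.mul_mono ha hb
  have hμ : Module.length R (I ⧸ (maximalIdeal R • ⊤ : Submodule R I)) ≠ e := by
    intro h
    rw [mu, rlength_eq_coe_length, h] at hmu
    exact lt_irrefl _ hmu
  have hlt := length_colon_lt hxm hx hN hk hμ
  obtain ⟨E⟩ := Ideal.nonempty_ext_one_equiv (maximalIdeal R) (ModuleCat.of R I)
  have hE : idealType R I = (Module.length R ((maximalIdeal R →ₗ[R] I) ⧸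
      LinearMap.range ((maximalIdeal R).restrictHom I)) : WithBot ℕ∞) :=
    (rlength_eq_coe_length _ _).trans (congrArg _ E.length_eq)
  have hQ : quotType R I =
      (Module.length R (R ⧸ maximalIdeal R →ₗ[R] R ⧸ I) : WithBot ℕ∞) := rlength_eq_coe_length _ _
  rw [EliasIdeal]
  refine le_antisymm (le_trans ?_ htype) ?_
  · have h := (Ideal.length_hom_quotient_range_restrictHom_le (I := I) hxm hx).trans_lt hlt
    rw [hE]
    generalize Module.length R ((maximalIdeal R →ₗ[R] I) ⧸
      LinearMap.range ((maximalIdeal R).restrictHom I)) = t at h ⊢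
    lift t to ℕ using h.ne_top
    exact WithBot.coe_le_coe.mpr (Nat.cast_le.mpr (Nat.le_sub_one_of_lt (Nat.cast_lt.mp h)))
  · rw [hE, hQ]
    exact WithBot.coe_le_coe.mpr (Ideal.length_hom_quotient_le hxm hx)
end

section
/- Let (R, m) be a one-dimensional Cohen-Macaulay local ring, R ⊆ S a finite birational extension (S ⊆ Q(R)), and I an m-primary ideal with IS = I. If I is Elias, then I : m ⊆ c_R(S), where c_R(S) = R :_{Q(R)} S is the conductor. -/
open CategoryTheory IsLocalRing

set_option synthInstance.maxHeartbeats 1000000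
set_option maxHeartbeats 1000000

universe u

/-- If `f` is surjective and vanishes on `ker g`, then the length of the target of `f` is at most
that of the target of `g`. -/
theorem Module.length_le_of_ker_le {R M N E : Type*} [CommRing R] [AddCommGroup M] [AddCommGroup N]
    [AddCommGroup E] [Module R M] [Module R N] [Module R E] (f : M →ₗ[R] N) (g : M →ₗ[R] E)
    (hf : Function.Surjective f) (h : LinearMap.ker g ≤ LinearMap.ker f) :
    Module.length R N ≤ Module.length R E :=
  calc
    Module.length R N ≤ Module.length R (M ⧸ LinearMap.ker g) :=
      Module.length_le_of_surjective ((LinearMap.ker g).liftQ f h) fun n ↦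
        (hf n).elim fun m hm ↦ ⟨Submodule.Quotient.mk m, by simpa using hm⟩
    _ = Module.length R (LinearMap.range g) := g.quotKerEquivRange.length_eq
    _ ≤ Module.length R E :=
      Module.length_le_of_injective _ (LinearMap.range g).injective_subtype

/-- An injective map into a module of no larger length is surjective, in finite length. -/
theorem LinearMap.surjective_of_injective_of_length_le {R M N : Type*} [CommRing R]
    [AddCommGroup M] [AddCommGroup N] [Module R M] [Module R N] (f : M →ₗ[R] N)
    (hf : Function.Injective f) (h : Module.length R N ≤ Module.length R M)
    (hM : Module.length R M ≠ ⊤) : Function.Surjective f := by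
  have hN : Module.length R N ≠ ⊤ := ne_top_of_le_ne_top hM h
  obtain ⟨_, _⟩ := isFiniteLength_iff_isNoetherian_isArtinian.mp (Module.length_ne_top_iff.mp hN)
  rw [← LinearMap.range_eq_top]
  by_contra hne
  have hlt := Submodule.length_lt hne
  rw [← (LinearEquiv.ofInjective f hf).length_eq] at hlt
  exact hlt.not_ge h

/-- A linear family of cocycles induces a map to cohomology, whose kernel consists of
coboundaries. -/
theorem exists_linearMap_homology {R : Type u} [CommRing R] (K : CochainComplex (ModuleCat.{u} R) ℕ)
    {B : Type u} [AddCommGroup B] [Module R B] (c : B →ₗ[R] K.X 1)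
    (hc : ∀ b, (K.d 1 2).hom (c b) = 0) :
    ∃ g : B →ₗ[R] K.homology 1, ∀ b, g b = 0 → ∃ z, (K.d 0 1).hom z = c b := by
  let k : ModuleCat.of R B ⟶ K.X 1 := ModuleCat.ofHom c
  have hk : k ≫ K.d 1 2 = 0 := by
    ext b
    exact hc b
  refine ⟨(K.liftCycles k 2 (by simp) hk ≫ K.homologyπ 1).hom, fun b hb ↦ ?_⟩
  have hex := ShortComplex.exact_of_g_is_cokernel
    (ShortComplex.mk (K.toCycles 0 1) (K.homologyπ 1) (by simp))
    (K.homologyIsCokernel 0 1 (by simp))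
  obtain ⟨z, hz⟩ := (ShortComplex.moduleCat_exact_iff _).mp hex
    ((K.liftCycles k 2 (by simp) hk).hom b) hb
  refine ⟨z, ?_⟩
  have h := congrArg (K.iCycles 1).hom hz
  have h₁ : (K.iCycles 1).hom ((K.toCycles 0 1).hom z) = (K.d 0 1).hom z := by
    rw [← K.toCycles_i 0 1]; rfl
  have h₂ : (K.iCycles 1).hom ((K.liftCycles k 2 (by simp) hk).hom b) = c b := by
    rw [← LinearMap.comp_apply, ← ModuleCat.hom_comp, K.liftCycles_i]; rfl
  exact h₁.symm.trans (h.trans h₂)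

/-- The elements `q` of `A` with `q • 𝔪 ⊆ J`. -/
def colonMaximal (R : Type u) [CommRing R] [IsLocalRing R] {A : Type*} [CommRing A] [Algebra R A]
    (J : Submodule R A) : Submodule R A where
  carrier := {q | ∀ x ∈ maximalIdeal R, x • q ∈ J}
  add_mem' ha hb x hx := by simpa using J.add_mem (ha x hx) (hb x hx)
  zero_mem' x _ := by simp
  smul_mem' r q hq x hx := by
    rw [smul_comm]
    exact J.smul_mem r (hq x hx)

section Colon

variable {R : Type u} [CommRing R]

/-- The image of an ideal in the total ring of fractions. -/
abbrev fractionImage (I : Ideal R) : Submodule R (FractionRing R) :=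
  Submodule.map (Algebra.linearMap R (FractionRing R)) I

theorem algebraMap_mem_fractionImage {I : Ideal R} {r : R} :
    algebraMap R (FractionRing R) r ∈ fractionImage I ↔ r ∈ I := by
  constructor
  · rintro ⟨i, hi, h⟩
    rwa [← IsFractionRing.injective R (FractionRing R) h]
  · exact fun h ↦ ⟨r, h, rfl⟩

/-- An ideal is isomorphic to its image in the total ring of fractions. -/
noncomputable def equivFractionImage (I : Ideal R) : I ≃ₗ[R] fractionImage I :=
  Submodule.equivMapOfInjective _ (IsFractionRing.injective R (FractionRing R)) I

theorem algebraMap_equivFractionImage_symm (I : Ideal R) (y : fractionImage I) :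
    algebraMap R (FractionRing R) ((equivFractionImage I).symm y) = y := by
  conv_rhs => rw [← (equivFractionImage I).apply_symm_apply y]
  rfl

variable [IsLocalRing R]

/-- Multiplication by `q ∈ I :_Q 𝔪`, applied after a map `φ : X → 𝔪`. -/
noncomputable def colonMulComp (I : Ideal R) {X : Type*} [AddCommGroup X] [Module R X]
    (φ : X →ₗ[R] maximalIdeal R) :
    colonMaximal R (fractionImage I) →ₗ[R] X →ₗ[R] I where
  toFun q := (equivFractionImage I).symm.toLinearMap ∘ₗ
    (LinearMap.toSpanSingleton R _ (q : FractionRing R) ∘ₗ Submodule.subtype _ ∘ₗ φ).codRestrict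
      (fractionImage I) fun p ↦ q.2 _ (φ p).2
  map_add' a b := by
    ext p
    apply IsFractionRing.injective R (FractionRing R)
    simp [algebraMap_equivFractionImage_symm]
    rfl
  map_smul' r a := by
    ext p
    apply IsFractionRing.injective R (FractionRing R)
    simp [algebraMap_equivFractionImage_symm, Algebra.smul_def, mul_left_comm]
    rw [← Algebra.smul_def (φ p : R)]
    rfl

theorem algebraMap_colonMulComp (I : Ideal R) {X : Type*} [AddCommGroup X] [Module R X]
    (φ : X →ₗ[R] maximalIdeal R) (q : colonMaximal R (fractionImage I)) (p : X) :
    algebraMap R (FractionRing R) (colonMulComp I φ q p) = (φ p : R) • (q : FractionRing R) :=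
  (algebraMap_equivFractionImage_symm I _).trans rfl

/-- If `d : X₁ → X₀` is a projective presentation of the residue field and `f : X₀ → R` lifts the
augmentation, then `q ∈ I :_Q 𝔪` lies in `I` as soon as the cocycle it defines is a coboundary. -/
theorem mem_fractionImage_of_coboundary (hreg : ∃ x ∈ maximalIdeal R, x ∈ nonZeroDivisors R)
    (I : Ideal R) {X₀ X₁ : Type*} [AddCommGroup X₀] [Module R X₀] [AddCommGroup X₁] [Module R X₁]
    (d : X₁ →ₗ[R] X₀) (f : X₀ →ₗ[R] R) (ε : X₀ →ₗ[R] ResidueField R)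
    (hε : Function.Surjective ε) (hd : ∀ y, ε y = 0 → ∃ p, d p = y)
    (hf : ∀ y, residue R (f y) = ε y) (φ : X₁ →ₗ[R] maximalIdeal R)
    (hφ : ∀ p, (φ p : R) = f (d p)) (q : colonMaximal R (fractionImage I)) (ψ : X₀ →ₗ[R] I)
    (h : ∀ p, ψ (d p) = colonMulComp I φ q p) :
    (q : FractionRing R) ∈ fractionImage I := by
  obtain ⟨x, hxm, hx⟩ := hreg
  obtain ⟨e, he⟩ := hε 1
  have hunit : IsUnit (f e) := by
    rw [← residue_ne_zero_iff_isUnit, hf, he]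
    exact one_ne_zero
  obtain ⟨p, hp⟩ := hd (x • e) (by
    rw [map_smul, he, Algebra.smul_def, mul_one]
    exact (residue_eq_zero_iff x).mpr hxm)
  have key := algebraMap_colonMulComp I φ q p
  rw [← h, hφ, hp, map_smul, map_smul, Submodule.coe_smul, smul_eq_mul, smul_eq_mul, map_mul,
    Algebra.smul_def, map_mul, mul_assoc] at key
  have hxu : IsUnit (algebraMap R (FractionRing R) x) :=
    IsLocalization.map_units (FractionRing R) ⟨x, hx⟩
  have key' := hxu.mul_left_cancel key
  obtain ⟨u, hu⟩ := hunit
  have hmem : f e • (q : FractionRing R) ∈ fractionImage I := by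
    rw [Algebra.smul_def, ← key']
    exact algebraMap_mem_fractionImage.mpr (ψ e).2
  have := (fractionImage I).smul_mem (↑u⁻¹ : R) hmem
  rwa [smul_smul, ← hu, Units.inv_mul, one_smul] at this

theorem exists_linearMap_ext (hreg : ∃ x ∈ maximalIdeal R, x ∈ nonZeroDivisors R) (I : Ideal R) :
    ∃ g : colonMaximal R (fractionImage I) →ₗ[R]
        ((_root_.Ext R (ModuleCat.{u} R) 1).obj
          (Opposite.op (ModuleCat.of R (ResidueField R)))).obj (ModuleCat.of R I),
      ∀ q, g q = 0 → (q : FractionRing R) ∈ fractionImage I := by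
  let P := projectiveResolution (ModuleCat.of R (ResidueField R))
  let ρ : ModuleCat.of R R ⟶ ModuleCat.of R (ResidueField R) :=
    ModuleCat.ofHom (Algebra.linearMap R (ResidueField R))
  have : Epi ρ := (ModuleCat.epi_iff_surjective _).mpr residue_surjective
  let ε : P.complex.X 0 ⟶ ModuleCat.of R (ResidueField R) := P.π.f 0
  have hε : Function.Surjective ε.hom :=
    (ModuleCat.epi_iff_surjective ε).mp (inferInstanceAs (Epi (P.π.f 0)))
  have hd : ∀ y, ε.hom y = 0 → ∃ p, (P.complex.d 1 0).hom p = y :=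
    (ShortComplex.moduleCat_exact_iff _).mp P.exact₀
  have hdε : ∀ p, ε.hom ((P.complex.d 1 0).hom p) = 0 := fun p ↦
    ShortComplex.moduleCat_zero_apply
      (ShortComplex.mk _ _ P.complex_d_comp_π_f_zero) p
  let f : P.complex.X 0 ⟶ ModuleCat.of R R := Projective.factorThru ε ρ
  have hf : ∀ y, residue R (f.hom y) = ε.hom y := fun y ↦
    congrArg (fun t ↦ t.hom y) (Projective.factorThru_comp ε ρ)
  let φ : P.complex.X 1 →ₗ[R] maximalIdeal R :=
    (f.hom ∘ₗ (P.complex.d 1 0).hom).codRestrict (maximalIdeal R) fun p ↦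
      (residue_eq_zero_iff _).mp ((hf _).trans (hdε p))
  have hφd : ∀ p, φ ((P.complex.d 2 1).hom p) = 0 := fun p ↦ by
    ext
    have : (P.complex.d 1 0).hom ((P.complex.d 2 1).hom p) = 0 :=
      congrArg (fun t ↦ t.hom p) (P.complex.d_comp_d 2 1 0)
    change f.hom ((P.complex.d 1 0).hom ((P.complex.d 2 1).hom p)) = 0
    rw [this, map_zero]
  let K := P.complex.linearYonedaObj R (ModuleCat.of R I)
  let c : colonMaximal R (fractionImage I) →ₗ[R] K.X 1 :=
    (ModuleCat.homLinearEquiv (S := R) (M := P.complex.X 1)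
      (N := ModuleCat.of R I)).symm.toLinearMap ∘ₗ colonMulComp I φ
  obtain ⟨g, hg⟩ := exists_linearMap_homology K c fun q ↦ by
    change P.complex.d 2 1 ≫ ModuleCat.ofHom (colonMulComp I φ q) = 0
    ext p
    apply IsFractionRing.injective R (FractionRing R)
    change algebraMap R (FractionRing R) (colonMulComp I φ q ((P.complex.d 2 1).hom p)) = _
    rw [algebraMap_colonMulComp, hφd]
    simp
  refine ⟨(P.isoExt 1 (ModuleCat.of R I)).inv.hom ∘ₗ g, fun q hq ↦ ?_⟩
  have hq' : g q = 0 :=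
    (P.isoExt (R := R) 1 (ModuleCat.of R I)).symm.toLinearEquiv.map_eq_zero_iff.mp hq
  obtain ⟨z, hz⟩ := hg q hq'
  let ψ : P.complex.X 0 ⟶ ModuleCat.of R I := z
  have hψ : P.complex.d 1 0 ≫ ψ = ModuleCat.ofHom (colonMulComp I φ q) := hz
  exact mem_fractionImage_of_coboundary hreg I (P.complex.d 1 0).hom f.hom ε.hom hε hd hf φ
    (fun _ ↦ rfl) q ψ.hom fun p ↦ congrArg (fun t ↦ t.hom p) hψ

theorem applyₗ_one_injective (N : Type*) [AddCommGroup N] [Module R N] :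
    Function.Injective
      (LinearMap.applyₗ (1 : ResidueField R) : (ResidueField R →ₗ[R] N) →ₗ[R] N) := by
  intro h₁ h₂ h
  ext y
  obtain ⟨r, rfl⟩ := residue_surjective y
  have hr : residue R r = r • (1 : ResidueField R) := by
    rw [Algebra.smul_def, mul_one]; rfl
  rw [hr, map_smul, map_smul]
  exact congrArg (r • ·) h

/-- The socle of `R ⧸ I` maps to the quotient of `I :_Q 𝔪` by `I`. -/
noncomputable def socleToColon (I : Ideal R) : (ResidueField R →ₗ[R] R ⧸ I) →ₗ[R]
    (colonMaximal R (fractionImage I)).map (fractionImage I).mkQ :=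
  (Submodule.mapQ I (fractionImage I) (Algebra.linearMap R (FractionRing R))
      (Submodule.le_comap_map _ _) ∘ₗ LinearMap.applyₗ (1 : ResidueField R)).codRestrict _
    fun h ↦ by
      obtain ⟨r, hr⟩ := Submodule.Quotient.mk_surjective I (h 1)
      refine ⟨algebraMap R (FractionRing R) r, fun x hx ↦ ?_, ?_⟩
      · rw [Algebra.smul_def, ← map_mul, algebraMap_mem_fractionImage,
          ← Submodule.Quotient.mk_eq_zero, ← smul_eq_mul, Submodule.Quotient.mk_smul, hr,
          ← map_smul, Algebra.smul_def, mul_one, ResidueField.algebraMap_eq,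
          (residue_eq_zero_iff x).mpr hx, map_zero]
      · exact congrArg (Submodule.mapQ I (fractionImage I) (Algebra.linearMap R (FractionRing R))
          (Submodule.le_comap_map _ _)) hr

theorem socleToColon_injective (I : Ideal R) : Function.Injective (socleToColon I) := by
  refine fun h₁ h₂ h ↦ applyₗ_one_injective (R ⧸ I) ?_
  have hι : Function.Injective (Submodule.mapQ I (fractionImage I)
      (Algebra.linearMap R (FractionRing R)) (Submodule.le_comap_map _ _)) := by
    rw [injective_iff_map_eq_zero]
    intro y hy
    obtain ⟨r, rfl⟩ := Submodule.Quotient.mk_surjective I y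
    rw [Submodule.mapQ_apply, Submodule.Quotient.mk_eq_zero] at hy
    exact (Submodule.Quotient.mk_eq_zero I).mpr (algebraMap_mem_fractionImage.mp hy)
  exact hι (congrArg Subtype.val h)

/-- An `𝔪`-primary Elias ideal satisfies `I :_Q 𝔪 ⊆ R`. -/
theorem EliasIdeal.mem_range_of_mem_colonMaximal [IsNoetherianRing R]
    (hreg : ∃ x ∈ maximalIdeal R, x ∈ nonZeroDivisors R) {I : Ideal R} (hI : IsMPrimary R I)
    (hE : EliasIdeal R I) {q : FractionRing R} (hq : q ∈ colonMaximal R (fractionImage I)) :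
    q ∈ Set.range (algebraMap R (FractionRing R)) := by
  obtain ⟨g, hg⟩ := exists_linearMap_ext hreg I
  have hext : Module.length R (((_root_.Ext R (ModuleCat.{u} R) 1).obj
      (Opposite.op (ModuleCat.of R (ResidueField R)))).obj (ModuleCat.of R I)) =
      Module.length R (ResidueField R →ₗ[R] R ⧸ I) := by
    apply WithBot.coe_injective
    rw [Module.coe_length, Module.coe_length]
    exact hE
  have hle : Module.length R ((colonMaximal R (fractionImage I)).map (fractionImage I).mkQ) ≤
      Module.length R (ResidueField R →ₗ[R] R ⧸ I) := by
    rw [← hext]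
    refine Module.length_le_of_ker_le
      ((fractionImage I).mkQ.submoduleMap (colonMaximal R (fractionImage I))) g
      (LinearMap.submoduleMap_surjective _ _) fun b hb ↦ ?_
    rw [LinearMap.mem_ker]
    ext
    simpa using hg b hb
  have hmin : maximalIdeal R ∈ I.minimalPrimes := by
    refine ⟨⟨(maximalIdeal.isMaximal R).isPrime, hI ▸ Ideal.le_radical⟩, fun J hJ _ ↦ ?_⟩
    rw [← hI]
    exact hJ.1.radical_le_iff.mpr hJ.2
  have := quotient_artinian_of_mem_minimalPrimes_of_isLocalRing I hmin
  have hfin : Module.length R (R ⧸ I) ≠ ⊤ := by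
    rw [Module.length_eq_of_surjective (R := R ⧸ I) Ideal.Quotient.mk_surjective]
    exact Module.length_ne_top
  obtain ⟨h, hh⟩ := (socleToColon I).surjective_of_injective_of_length_le
    (socleToColon_injective I) hle
    (ne_top_of_le_ne_top hfin (Module.length_le_of_injective _ (applyₗ_one_injective _)))
    ⟨_, Submodule.mem_map_of_mem hq⟩
  obtain ⟨r, hr⟩ := Submodule.Quotient.mk_surjective I (h 1)
  have hrq : Submodule.Quotient.mk (algebraMap R (FractionRing R) r) =
      (Submodule.Quotient.mk q : FractionRing R ⧸ fractionImage I) :=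
    (congrArg (Submodule.mapQ I (fractionImage I) (Algebra.linearMap R (FractionRing R))
      (Submodule.le_comap_map _ _)) hr).trans (congrArg Subtype.val hh)
  obtain ⟨i, -, hi⟩ := (Submodule.Quotient.eq _).mp hrq
  refine ⟨r - i, ?_⟩
  rw [map_sub, ← Algebra.linearMap_apply R _ i, hi, sub_sub_cancel]

end Colon

theorem elias_colon_le_conductor (R : Type u) [CommRing R] [IsLocalRing R] [IsNoetherianRing R]
    (hdim : ringKrullDim R = 1)
    (hCM : ∃ x ∈ maximalIdeal R, x ∈ nonZeroDivisors R)
    (S : Subalgebra R (FractionRing R)) [Module.Finite R S]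
    (I : Ideal R) (hI : IsMPrimary R I)
    (hIS : ∀ s ∈ S, ∀ i ∈ I, s * algebraMap R (FractionRing R) i ∈
      Submodule.map (Algebra.linearMap R (FractionRing R)) I)
    (hE : EliasIdeal R I) :
    ∀ r ∈ I.colon (maximalIdeal R), ∀ s ∈ S,
      algebraMap R (FractionRing R) r * s ∈
        Set.range (algebraMap R (FractionRing R)) := by
  intro r hr s hs
  refine hE.mem_range_of_mem_colonMaximal hCM hI fun x hx ↦ ?_
  have hrx : r * x ∈ I := Submodule.mem_colon.mp hr x hx
  convert hIS s hs _ hrx using 1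
  rw [Algebra.smul_def, map_mul]
  ring
end
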